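/- (Lemma 1, truncated expected improvement.) Let X be a real random variable with Gaussian distribution of mean μ and variance σ², where σ > 0, and let y ≤ M be real numbers. Set u₁ = (y − μ)/σ and u₂ = (M − μ)/σ. Then E[(X − y)·1_{y ≤ X ≤ M}] = σ·(φ(u₁) − φ(u₂) + u₁·Φ(u₁) − u₁·Φ(u₂)), where Φ is the standard normal CDF and φ is the standard normal PDF. -/

import Mathlib

open MeasureTheory ProbabilityTheory Real

/-- The probability density function of the standard normal distribution. -/
noncomputable def stdNormalPDF (t : ℝ) : ℝ :=
  (Real.sqrt (2 * Real.pi))⁻¹ * Real.exp (-t ^ 2 / 2)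

/-- The cumulative distribution function of the standard normal distribution. -/
noncomputable def stdNormalCDF (t : ℝ) : ℝ :=
  ∫ s in Set.Iic t, stdNormalPDF s

lemma stdNormalPDF_eq_gaussianPDFReal : stdNormalPDF = gaussianPDFReal 0 1 := by
  ext t
  simp [stdNormalPDF, gaussianPDFReal]

lemma continuous_stdNormalPDF : Continuous stdNormalPDF := by
  unfold stdNormalPDF
  fun_prop

lemma integrable_stdNormalPDF : Integrable stdNormalPDF :=
  stdNormalPDF_eq_gaussianPDFReal ▸ integrable_gaussianPDFReal 0 1

lemma hasDerivAt_stdNormalPDF (t : ℝ) : HasDerivAt stdNormalPDF (-t * stdNormalPDF t) t := by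
  have h : HasDerivAt (fun s : ℝ => -s ^ 2 / 2) (-t) t := by
    refine ((hasDerivAt_pow 2 t).neg.div_const 2).congr_deriv ?_
    norm_num
    ring
  refine (h.exp.const_mul (Real.sqrt (2 * Real.pi))⁻¹).congr_deriv ?_
  rw [stdNormalPDF]
  ring

lemma hasDerivAt_stdNormalCDF (t : ℝ) : HasDerivAt stdNormalCDF (stdNormalPDF t) t := by
  have h : stdNormalCDF = fun u => (∫ s in (0 : ℝ)..u, stdNormalPDF s) + stdNormalCDF 0 := by
    ext u
    rw [← intervalIntegral.integral_Iic_sub_Iic integrable_stdNormalPDF.integrableOn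
      integrable_stdNormalPDF.integrableOn]
    simp [stdNormalCDF]
  rw [h]
  exact (continuous_stdNormalPDF.integral_hasStrictDerivAt 0 t).hasDerivAt.add_const _

lemma gaussianPDFReal_eq_stdNormalPDF (μ : ℝ) {σ : ℝ} (hσ : 0 < σ) {v : NNReal}
    (hv : (v : ℝ) = σ ^ 2) (x : ℝ) :
    gaussianPDFReal μ v x = σ⁻¹ * stdNormalPDF ((x - μ) / σ) := by
  have hsqrt : √(2 * π * σ ^ 2) = √(2 * π) * σ := by
    rw [Real.sqrt_mul (by positivity), Real.sqrt_sq hσ.le]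
  have hexp : -(x - μ) ^ 2 / (2 * σ ^ 2) = -((x - μ) / σ) ^ 2 / 2 := by
    field_simp
  simp only [gaussianPDFReal, stdNormalPDF, hv, hsqrt, hexp, mul_inv]
  ring

/-- An antiderivative of the Gaussian density weighted by the improvement `x - y`. -/
lemma hasDerivAt_gaussian_improvement (μ y : ℝ) {σ : ℝ} (hσ : σ ≠ 0) (x : ℝ) :
    HasDerivAt
      (fun x => -σ * stdNormalPDF ((x - μ) / σ) - (y - μ) * stdNormalCDF ((x - μ) / σ))
      (σ⁻¹ * stdNormalPDF ((x - μ) / σ) * (x - y)) x := by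
  have hu : HasDerivAt (fun x => (x - μ) / σ) (1 / σ) x :=
    ((hasDerivAt_id x).sub_const μ).div_const σ
  refine ((((hasDerivAt_stdNormalPDF _).comp x hu).const_mul (-σ)).sub
    (((hasDerivAt_stdNormalCDF _).comp x hu).const_mul (y - μ))).congr_deriv ?_
  field_simp
  ring

/-- Lemma 1 (truncated expected improvement): for a Gaussian `X` with mean `μ` and
variance `σ²`, and thresholds `y ≤ M`, with `u₁ = (y - μ)/σ` and `u₂ = (M - μ)/σ`,
`E[(X - y) · 1_{y ≤ X ≤ M}] = σ (φ(u₁) - φ(u₂) + u₁ Φ(u₁) - u₁ Φ(u₂))`. -/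
theorem truncated_expected_improvement_gaussian
    {Ω : Type*} [MeasurableSpace Ω] (P : Measure Ω) [IsProbabilityMeasure P]
    (X : Ω → ℝ) (μ σ y M : ℝ) (hσ : 0 < σ) (hyM : y ≤ M)
    (hX : Measure.map X P = gaussianReal μ ⟨σ ^ 2, sq_nonneg σ⟩) :
    ∫ ω, Set.indicator {ω | y ≤ X ω ∧ X ω ≤ M} (fun ω => X ω - y) ω ∂P
      = σ * (stdNormalPDF ((y - μ) / σ) - stdNormalPDF ((M - μ) / σ)
          + ((y - μ) / σ) * stdNormalCDF ((y - μ) / σ)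
          - ((y - μ) / σ) * stdNormalCDF ((M - μ) / σ)) := by
  obtain ⟨v, hv, hX⟩ : ∃ v : NNReal, (v : ℝ) = σ ^ 2 ∧ P.map X = gaussianReal μ v :=
    ⟨_, rfl, hX⟩
  have hv0 : v ≠ 0 := by
    rw [← NNReal.coe_ne_zero, hv]
    positivity
  have hXm : AEMeasurable X P := by
    refine AEMeasurable.of_map_ne_zero ?_
    rw [hX]
    exact IsProbabilityMeasure.ne_zero _
  have hmap : ∫ ω, Set.indicator {ω | y ≤ X ω ∧ X ω ≤ M} (fun ω => X ω - y) ω ∂P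
      = ∫ x, (Set.Icc y M).indicator (fun x => x - y) x ∂(P.map X) :=
    (integral_map hXm ((measurable_id.sub_const y).indicator
      measurableSet_Icc).aestronglyMeasurable).symm
  have hdensity : ∀ x, gaussianPDFReal μ v x •
      (Set.Icc y M).indicator (fun x => x - y) x
      = (Set.Icc y M).indicator
        (fun x => σ⁻¹ * stdNormalPDF ((x - μ) / σ) * (x - y)) x := by
    intro x
    rw [gaussianPDFReal_eq_stdNormalPDF μ hσ hv, smul_eq_mul, Set.indicator_mul_right]
  have hcont : Continuous fun x => σ⁻¹ * stdNormalPDF ((x - μ) / σ) * (x - y) := by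
    have := continuous_stdNormalPDF
    fun_prop
  rw [hmap, hX, integral_gaussianReal_eq_integral_smul hv0, integral_congr_ae (.of_forall hdensity),
    integral_indicator measurableSet_Icc, integral_Icc_eq_integral_Ioc,
    ← intervalIntegral.integral_of_le hyM,
    intervalIntegral.integral_eq_sub_of_hasDerivAt
      (fun x _ => hasDerivAt_gaussian_improvement μ y hσ.ne' x) (hcont.intervalIntegrable _ _)]
  field_simp
  ring
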